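/- Let X be a profinite topological space (compact, Hausdorff and totally disconnected) and let N be a ℤ_p-module that is p-adically separated and complete. Then the restriction map Hom_{ℤ_p}(C(X, ℤ_p), N) → Hom_{ℤ_p}(LC(X, ℤ_p), N), given by precomposition with the inclusion of locally constant functions into continuous functions, is bijective. -/

import Mathlib

/-- A linear map `ι : A → B` that is injective and surjective modulo every power of `π` induces
a bijection on linear maps to any `π`-adically complete module. -/
theorem IsAdicComplete.bijective_comp_of_dense_of_pure {R A B N : Type*} [CommRing R]
    [AddCommGroup A] [Module R A] [AddCommGroup B] [Module R B] [AddCommGroup N] [Module R N]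
    (π : R) [IsAdicComplete (Ideal.span {π}) N] (ι : A →ₗ[R] B)
    (hdense : ∀ (n : ℕ) (b : B), ∃ (a : A) (c : B), b = ι a + π ^ n • c)
    (hpure : ∀ (n : ℕ) (a : A) (c : B), ι a = π ^ n • c → ∃ a' : A, a = π ^ n • a') :
    Function.Bijective (fun φ : B →ₗ[R] N => φ ∘ₗ ι) := by
  set I : Ideal R := Ideal.span {π} with hI
  have pow_smul_mem (n : ℕ) (y : N) : π ^ n • y ∈ (I ^ n • ⊤ : Submodule R N) :=
    Submodule.smul_mem_smul (Ideal.pow_mem_pow (Ideal.mem_span_singleton_self π) n) trivial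
  constructor
  · intro φ ψ h
    ext b
    refine (IsHausdorff.eq_iff_smodEq (I := I)).2 fun n => ?_
    obtain ⟨a, c, rfl⟩ := hdense n b
    have ha : φ (ι a) = ψ (ι a) := LinearMap.congr_fun h a
    rw [SModEq.sub_mem, map_add, map_add, ha, add_sub_add_left_eq_sub, map_smul, map_smul,
      ← smul_sub]
    exact pow_smul_mem n _
  · intro φ
    choose a c hac using hdense
    have key (n : ℕ) (b : B) (x : A) (y : B) (hb : b = ι x + π ^ n • y) :
        (Submodule.Quotient.mk (φ (a n b)) : N ⧸ (I ^ n • ⊤ : Submodule R N)) =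
          Submodule.Quotient.mk (φ x) := by
      obtain ⟨z, hz⟩ := hpure n (a n b - x) (y - c n b) (by
        rw [map_sub, smul_sub, sub_eq_sub_iff_add_eq_add, ← hac n b, hb, add_comm])
      rw [Submodule.Quotient.eq, ← map_sub, hz, map_smul]
      exact pow_smul_mem n _
    let f (n : ℕ) : B →ₗ[R] N ⧸ (I ^ n • ⊤ : Submodule R N) :=
      { toFun := fun b => Submodule.Quotient.mk (φ (a n b))
        map_add' := fun b b' => by
          rw [key n (b + b') (a n b + a n b') (c n b + c n b') (by
            conv_lhs => rw [hac n b, hac n b']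
            rw [map_add, smul_add, add_add_add_comm]), map_add, Submodule.Quotient.mk_add]
        map_smul' := fun r b => by
          rw [key n (r • b) (r • a n b) (r • c n b) (by
            conv_lhs => rw [hac n b]
            rw [map_smul, smul_add, smul_comm r]), map_smul, Submodule.Quotient.mk_smul,
            RingHom.id_apply] }
    have hf {m n : ℕ} (hle : m ≤ n) : Submodule.factorPow I N hle ∘ₗ f n = f m := by
      ext b
      refine (key m b (a n b) (π ^ (n - m) • c n b) ?_).symm
      rw [smul_smul, ← pow_add, Nat.add_sub_cancel' hle]
      exact hac n b
    refine ⟨IsAdicComplete.lift I f hf, LinearMap.ext fun x => ?_⟩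
    refine (IsHausdorff.eq_iff_smodEq (I := I)).2 fun n => ?_
    exact (IsAdicComplete.mk_lift I hf n (ι x)).trans (key n (ι x) x 0 (by simp))

namespace PadicInt

variable {p : ℕ} [Fact p.Prime]

theorem isLocallyConstant_toZModPow (n : ℕ) :
    IsLocallyConstant (toZModPow n : ℤ_[p] → ZMod (p ^ n)) := by
  refine (IsLocallyConstant.iff_eventually_eq _).2 fun x => ?_
  have hpos : (0 : ℝ) < (p : ℝ) ^ (-n : ℤ) :=
    zpow_pos (by exact_mod_cast (Fact.out : p.Prime).pos) _
  filter_upwards [Metric.ball_mem_nhds x hpos] with y hy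
  rw [Metric.mem_ball, dist_eq_norm] at hy
  rw [← sub_eq_zero, ← map_sub, ← RingHom.mem_ker, ker_toZModPow]
  exact (norm_le_pow_iff_mem_span_pow _ n).1 hy.le

theorem pow_dvd_sub_val_toZModPow (n : ℕ) (x : ℤ_[p]) :
    (p : ℤ_[p]) ^ n ∣ x - ((toZModPow n x).val : ℤ_[p]) := by
  have : NeZero (p ^ n) := ⟨pow_ne_zero _ (Fact.out : p.Prime).ne_zero⟩
  rw [← Ideal.mem_span_singleton, ← ker_toZModPow, RingHom.mem_ker, map_sub, map_natCast,
    ZMod.natCast_zmod_val, sub_self]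

theorem isClosedEmbedding_pow_mul (n : ℕ) :
    Topology.IsClosedEmbedding (fun x : ℤ_[p] => (p : ℤ_[p]) ^ n * x) :=
  Continuous.isClosedEmbedding (by fun_prop)
    (mul_right_injective₀ (pow_ne_zero n prime_p.ne_zero))

/-- A continuous `p`-adic function is locally constant modulo every power of `p`. -/
theorem exists_locallyConstant_add_pow_smul {X : Type*} [TopologicalSpace X] (n : ℕ)
    (f : C(X, ℤ_[p])) : ∃ (g : LocallyConstant X ℤ_[p]) (h : C(X, ℤ_[p])),
      f = (g : C(X, ℤ_[p])) + (p : ℤ_[p]) ^ n • h := by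
  let g : LocallyConstant X ℤ_[p] :=
    ⟨fun x => ((toZModPow n (f x)).val : ℤ_[p]),
      ((isLocallyConstant_toZModPow n).comp_continuous f.continuous).comp
        fun z : ZMod (p ^ n) => (z.val : ℤ_[p])⟩
  choose h hh using fun x => pow_dvd_sub_val_toZModPow n (f x)
  have hcont : Continuous h := by
    refine (isClosedEmbedding_pow_mul n).isInducing.continuous_iff.2 ?_
    exact (f.continuous.sub g.continuous).congr hh
  exact ⟨g, ⟨h, hcont⟩, ContinuousMap.ext fun x => sub_eq_iff_eq_add'.1 (hh x)⟩

end PadicInt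

theorem LocallyConstant.exists_eq_smul_of_forall_dvd {X R : Type*} [TopologicalSpace X]
    [CommRing R] (r : R) (g : LocallyConstant X R) (hg : ∀ x, r ∣ g x) :
    ∃ g' : LocallyConstant X R, g = r • g' := by
  classical
  refine ⟨g.map fun y => if h : r ∣ y then h.choose else 0, LocallyConstant.ext fun x => ?_⟩
  simpa [hg x] using (hg x).choose_spec

/-- For a profinite space `X` and a `p`-adically separated and complete `ℤ_p`-module `N`,
restriction from continuous to locally constant functions induces a bijection
`Hom_{ℤ_p}(C(X, ℤ_p), N) ≃ Hom_{ℤ_p}(LC(X, ℤ_p), N)`. -/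
theorem restriction_to_locally_constant_bijective
    (p : ℕ) [Fact p.Prime]
    (X : Type*) [TopologicalSpace X] [CompactSpace X] [T2Space X]
    [TotallyDisconnectedSpace X]
    (N : Type*) [AddCommGroup N] [Module ℤ_[p] N]
    [IsAdicComplete (Ideal.span {(p : ℤ_[p])}) N] :
    Function.Bijective
      (fun φ : C(X, ℤ_[p]) →ₗ[ℤ_[p]] N =>
        φ ∘ₗ (LocallyConstant.toContinuousMapLinearMap ℤ_[p] :
          LocallyConstant X ℤ_[p] →ₗ[ℤ_[p]] C(X, ℤ_[p]))) := by
  refine IsAdicComplete.bijective_comp_of_dense_of_pure (p : ℤ_[p]) _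
    PadicInt.exists_locallyConstant_add_pow_smul fun n g h hgh => ?_
  exact g.exists_eq_smul_of_forall_dvd _ fun x => ⟨h x, DFunLike.congr_fun hgh x⟩
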